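/- arXiv:math/0201085 — 3 statements merged into one kernel-verified Lean document; each statement's English description precedes it below -/
import Mathlib

section
/- For every integer n ≥ 1, the determinant of the generic symmetric n × n matrix is an irreducible polynomial; that is, in the polynomial ring ℂ[x_{ij} : 1 ≤ i ≤ j ≤ n], the element det(M), where M is the symmetric matrix with entries M_{ij} = x_{min(i,j), max(i,j)}, is irreducible. -/
/-- The index set of the coordinate ring `ℂ[x_{ij} : 1 ≤ i ≤ j ≤ n]` of the affine
space `Sym_n` of symmetric `n × n` matrices. -/
def SymVar (n : ℕ) : Type := {p : Fin n × Fin n // p.1 ≤ p.2}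

/-- The generic symmetric `n × n` matrix, with `(i, j)` entry the variable
`x_{min(i,j), max(i,j)}`. -/
noncomputable def genericSymMatrix (n : ℕ) :
    Matrix (Fin n) (Fin n) (MvPolynomial (SymVar n) ℂ) :=
  fun i j => MvPolynomial.X ⟨(min i j, max i j), min_le_max⟩

/-- The determinant of a matrix with entries in a subalgebra lies in that subalgebra. -/
theorem Matrix.det_mem_subalgebra {R A m : Type*} [CommRing R] [CommRing A] [Algebra R A]
    [Fintype m] [DecidableEq m] (S : Subalgebra R A) {M : Matrix m m A} (hM : ∀ i j, M i j ∈ S) :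
    M.det ∈ S := by
  rw [Matrix.det_apply]
  refine sum_mem fun τ _ ↦ ?_
  rw [Units.smul_def]
  exact zsmul_mem (prod_mem fun i _ ↦ hM _ _) _

/-- A symmetric matrix of variables, with no coincidences between entries other than those forced
by symmetry, has irreducible determinant. -/
theorem MvPolynomial.irreducible_det_of_symm {K σ : Type*} [Field K] (n : ℕ)
    (v : Fin (n + 1) → Fin (n + 1) → σ)
    (hv : ∀ i j k l, v i j = v k l ↔ (i = k ∧ j = l) ∨ (i = l ∧ j = k)) :
    Irreducible (Matrix.of fun i j ↦ (X (v i j) : MvPolynomial σ K)).det := by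
  induction n with
  | zero => simpa using (MvPolynomial.X_prime (i := v 0 0)).irreducible
  | succ n ih =>
    have hD := ih (fun i j ↦ v i.succ j.succ) (by simp [hv])
    set D := (Matrix.of fun i j : Fin (n + 1) ↦ (X (v i.succ j.succ) : MvPolynomial σ K)).det
      with hDdef
    set M := Matrix.of fun i j ↦ (X (v i j) : MvPolynomial σ K) with hM
    set g := ∑ j : Fin (n + 1), (-1) ^ (j.succ : ℕ) * M 0 j.succ *
      (M.submatrix Fin.succ j.succ.succAbove).det with hg
    have hdet : M.det = D * X (v 0 0) + g := by
      rw [Matrix.det_succ_row_zero, Fin.sum_univ_succ]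
      congr 1
      simp only [Fin.val_zero, pow_zero, one_mul, Fin.succAbove_zero, mul_comm D]
      rfl
    have not_mem_vars {p : MvPolynomial σ K} (hp : p ∈ supported K {v 0 0}ᶜ) :
        v 0 0 ∉ p.vars := fun h ↦ mem_supported.1 hp h rfl
    have hX (i j) (h : ¬ (i = 0 ∧ j = 0)) :
        (X (v i j) : MvPolynomial σ K) ∈ supported K {v 0 0}ᶜ := by
      rw [X_mem_supported]
      simpa [hv] using h
    rw [hdet]
    refine irreducible_mul_X_add _ _ _ hD.ne_zero (not_mem_vars ?_) (not_mem_vars ?_) ?_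
    · exact Matrix.det_mem_subalgebra _ fun i j ↦ hX _ _ (by simp)
    · refine sum_mem fun j _ ↦ mul_mem (mul_mem ?_ (hX _ _ (by simp))) ?_
      · exact pow_mem (neg_mem (one_mem _)) _
      · exact Matrix.det_mem_subalgebra _ fun i k ↦ hX _ _ (by simp)
    · rw [hD.isRelPrime_iff_not_dvd]
      intro hdvd
      classical
      let τ : Equiv.Perm (Fin (n + 2)) := Equiv.swap 0 1
      let p : σ → K := fun s ↦ if ∃ i, s = v i (τ i) then 1 else 0
      have hτ (i) : τ (τ i) = i := Equiv.swap_apply_self ..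
      have hp (i j) : p (v i j) = if τ i = j then 1 else 0 := by
        refine if_congr ?_ rfl rfl
        simp only [hv]
        constructor
        · rintro ⟨k, ⟨rfl, rfl⟩ | ⟨rfl, rfl⟩⟩
          · rfl
          · exact hτ _
        · rintro rfl
          exact ⟨i, .inl ⟨rfl, rfl⟩⟩
      have hDp : eval p D = 0 := by
        rw [hDdef, RingHom.map_det]
        refine Matrix.det_eq_zero_of_row_eq_zero 0 fun j ↦ ?_
        simp only [RingHom.mapMatrix_apply, Matrix.map_apply, Matrix.of_apply, eval_X, hp]
        simp [τ, (Fin.succ_ne_zero j).symm]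
      have hMp : eval p M.det = -1 := by
        have : (eval p).mapMatrix M = τ.permMatrix K := by
          ext i j
          simp [hM, hp, PEquiv.toMatrix_apply, eq_comm]
        rw [RingHom.map_det, this, Matrix.det_permutation]
        simp [τ]
      have hdvd' : D ∣ M.det := hdet ▸ dvd_add (dvd_mul_right _ _) hdvd
      have := map_dvd (eval p) hdvd'
      rw [hDp, hMp] at this
      simp at this

/-- For every `n ≥ 1`, the determinant of the generic symmetric
`n × n` matrix is an irreducible polynomial in `ℂ[x_{ij} : 1 ≤ i ≤ j ≤ n]`. -/
theorem statement_14 (n : ℕ) (hn : 1 ≤ n) :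
    Irreducible (genericSymMatrix n).det := by
  obtain ⟨n, rfl⟩ := Nat.exists_eq_add_of_le' hn
  refine MvPolynomial.irreducible_det_of_symm n
    (fun i j ↦ (⟨(min i j, max i j), min_le_max⟩ : SymVar (n + 1))) fun i j k l ↦ ?_
  rw [Subtype.ext_iff, Prod.ext_iff]
  grind
end

section
/- For every integer n ≥ 1, the ring ℂ[x_{ij} (1 ≤ i ≤ j ≤ n), z] / (z² − det(M)), where M is the generic symmetric n × n matrix with entries M_{ij} = x_{min(i,j),max(i,j)}, is an integrally closed integral domain; equivalently, the affine variety ℍ_n := {(h, z) ∈ Sym_n × ℂ : z² − det(h) = 0} is a normal variety. -/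
/-- The coordinate ring `ℂ[x_{ij} (1 ≤ i ≤ j ≤ n), z] / (z² − det M)` of the affine
variety `ℍ_n = {(h, z) ∈ Sym_n × ℂ : z² − det h = 0}`, where `M` is the generic
symmetric `n × n` matrix. -/
noncomputable abbrev HnCoordRing (n : ℕ) : Type :=
  Polynomial (MvPolynomial (SymVar n) ℂ) ⧸
    Ideal.span {Polynomial.X ^ 2 - Polynomial.C ((genericSymMatrix n).det)}

theorem dvd_of_squarefree_of_sq_dvd_sq_mul {R : Type*} [CommRing R] [IsDomain R]
    [UniqueFactorizationMonoid R] {b c d : R} (hd : Squarefree d) (h : c ^ 2 ∣ b ^ 2 * d) :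
    c ∣ b := by
  by_cases hc : c = 0
  · subst hc
    simpa [hd.ne_zero] using h
  obtain ⟨c', b', g, hrel, rfl, rfl⟩ := UniqueFactorizationMonoid.exists_reduced_factors c hc b
  have hg : g ≠ 0 := by rintro rfl; simp at hc
  rw [mul_pow, mul_pow, mul_assoc, mul_dvd_mul_iff_left (pow_ne_zero 2 hg)] at h
  have hcd : c' ^ 2 ∣ d := (hrel.pow (m := 2) (n := 2)).dvd_of_dvd_mul_left h
  have hu : IsUnit c' := hd c' (by rwa [← sq])
  exact mul_dvd_mul_left g hu.dvd

theorem dvd_of_isIntegral_of_mul_eq {R L : Type*} [CommRing R] [IsDomain R] [IsIntegrallyClosed R]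
    [Field L] [Algebra R L] (hinj : Function.Injective (algebraMap R L)) {a c : R} (hc : c ≠ 0)
    {y : L} (hy : IsIntegral R y) (h : y * algebraMap R L c = algebraMap R L a) : c ∣ a := by
  let f : FractionRing R →ₐ[R] L := IsFractionRing.liftAlgHom (g := Algebra.ofId R L) hinj
  have hcL : algebraMap R L c ≠ 0 := by simpa using hinj.ne hc
  have hcK : algebraMap R (FractionRing R) c ≠ 0 := by simpa using hc
  have hf : f (algebraMap R _ a / algebraMap R _ c) = y := by
    rw [map_div₀, AlgHom.commutes, AlgHom.commutes, ← h, mul_div_cancel_right₀ _ hcL]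
  rw [← hf, isIntegral_algHom_iff f f.injective] at hy
  obtain ⟨r, hr⟩ := IsIntegrallyClosed.algebraMap_eq_of_integral hy
  refine ⟨r, IsFractionRing.injective R (FractionRing R) ?_⟩
  rw [map_mul, hr, mul_div_cancel₀ _ hcK]

theorem isIntegrallyClosed_of_sq_eq_squarefree {R S : Type*} [CommRing R] [IsDomain R]
    [UniqueFactorizationMonoid R] [CommRing S] [IsDomain S] [Algebra R S]
    (hinj : Function.Injective (algebraMap R S)) (h2 : IsUnit (2 : R)) {d : R}
    (hd : Squarefree d) {z : S} (hz : z ^ 2 = algebraMap R S d)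
    (hspan : ∀ s : S, ∃ a b : R, s = algebraMap R S a + algebraMap R S b * z)
    (σ : S ≃ₐ[R] S) (hσ : σ z = -z) : IsIntegrallyClosed S := by
  let L := FractionRing S
  have hint : Algebra.IsIntegral R S := ⟨fun s ↦ by
    obtain ⟨a, b, rfl⟩ := hspan s
    have hzi : IsIntegral R z := IsIntegral.of_pow two_pos (hz ▸ isIntegral_algebraMap)
    exact isIntegral_algebraMap.add (isIntegral_algebraMap.mul hzi)⟩
  have hinjL : Function.Injective (algebraMap R L) := by
    rw [IsScalarTower.algebraMap_eq R S L]
    exact (IsFractionRing.injective S L).comp hinj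
  rw [isIntegrallyClosed_iff L]
  intro y hyS
  have hy : IsIntegral R y := isIntegral_trans y hyS
  obtain ⟨s, t, ht, rfl⟩ := IsFractionRing.div_surjective S y
  have ht0 : t ≠ 0 := nonZeroDivisors.ne_zero ht
  obtain ⟨u, v, huv⟩ := hspan t
  have hnorm : t * σ t = algebraMap R S (u ^ 2 - v ^ 2 * d) := by
    simp only [huv, map_add, map_mul, AlgEquiv.commutes, hσ, map_sub, map_pow, ← hz]
    ring
  obtain ⟨a, b, hab⟩ := hspan (s * σ t)
  set c := u ^ 2 - v ^ 2 * d
  have hσt : σ t ≠ 0 := by simpa using ht0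
  have hc : c ≠ 0 := by
    intro h
    rw [h, map_zero] at hnorm
    exact mul_ne_zero ht0 hσt hnorm
  set y := algebraMap S L s / algebraMap S L t
  have hiS : Function.Injective (algebraMap S L) := IsFractionRing.injective S L
  have htL : algebraMap S L t ≠ 0 := by simpa using ht0
  set ζ := algebraMap S L z
  have hyc : y * algebraMap R L c = algebraMap R L a + algebraMap R L b * ζ := by
    have := congrArg (algebraMap S L) hab
    simp only [map_add, map_mul, ← IsScalarTower.algebraMap_apply] at this
    rw [IsScalarTower.algebraMap_apply R S L c, ← hnorm, map_mul, ← mul_assoc,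
      div_mul_cancel₀ _ htL, this]
  let τ : L ≃ₐ[R] L := IsFractionRing.algEquivOfAlgEquiv σ
  have hτζ : τ ζ = -ζ := by
    simp [τ, ζ, hσ]
  have hτyc : τ y * algebraMap R L c = algebraMap R L a - algebraMap R L b * ζ := by
    have := congrArg τ hyc
    simp only [map_add, map_mul, AlgEquiv.commutes, hτζ] at this
    rw [this]; ring
  have hτy : IsIntegral R (τ y) := hy.map τ
  have hca : c ∣ a := by
    have : c ∣ 2 * a := dvd_of_isIntegral_of_mul_eq hinjL hc (hy.add hτy) (by
      rw [add_mul, hyc, hτyc, map_mul, map_ofNat]; ring)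
    exact h2.dvd_mul_left.mp this
  obtain ⟨a', rfl⟩ := hca
  have hcL : algebraMap R L c ≠ 0 := by simpa using hinjL.ne hc
  have hζ : ζ ^ 2 = algebraMap R L d := by
    rw [IsScalarTower.algebraMap_apply R S L, ← hz, map_pow]
  have hcb : c ∣ b := by
    apply dvd_of_squarefree_of_sq_dvd_sq_mul hd
    refine dvd_of_isIntegral_of_mul_eq hinjL (pow_ne_zero 2 hc)
      ((hy.sub (isIntegral_algebraMap (x := a'))).pow 2) ?_
    rw [map_pow, ← mul_pow, sub_mul, hyc, map_mul, map_mul, ← hζ, map_pow]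
    ring
  obtain ⟨b', rfl⟩ := hcb
  refine ⟨algebraMap R S a' + algebraMap R S b' * z, ?_⟩
  apply mul_right_cancel₀ hcL
  rw [hyc]
  simp only [map_add, map_mul, ← IsScalarTower.algebraMap_apply]
  ring

open Polynomial in
theorem isDomain_and_isIntegrallyClosed_quotient_X_sq_sub_C {R : Type*} [CommRing R] [IsDomain R]
    [UniqueFactorizationMonoid R] (h2 : IsUnit (2 : R)) {d : R} (hd : Squarefree d)
    (hdu : ¬ IsUnit d) :
    IsDomain (R[X] ⧸ Ideal.span {(X ^ 2 - C d : R[X])}) ∧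
      IsIntegrallyClosed (R[X] ⧸ Ideal.span {(X ^ 2 - C d : R[X])}) := by
  have hmonic : (X ^ 2 - C d : R[X]).Monic := monic_X_pow_sub_C d two_ne_zero
  have hdeg : (X ^ 2 - C d : R[X]).natDegree = 2 := natDegree_X_pow_sub_C
  have hirr : Irreducible (X ^ 2 - C d : R[X]) := by
    rw [hmonic.irreducible_iff_roots_eq_zero_of_degree_le_three (by omega) (by omega)]
    refine Multiset.eq_zero_of_forall_notMem fun r hr ↦ hdu ?_
    have hr' : r ^ 2 - d = 0 := by simpa using (mem_roots'.mp hr).2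
    rw [sub_eq_zero] at hr'
    have hru : IsUnit r := hd r (by rw [← hr', sq])
    exact hr' ▸ hru.pow 2
  have hdom : IsDomain (R[X] ⧸ Ideal.span {(X ^ 2 - C d : R[X])}) := by
    rw [Ideal.Quotient.isDomain_iff_prime]
    exact (Ideal.span_singleton_prime hirr.ne_zero).mpr hirr.prime
  refine ⟨hdom, ?_⟩
  set I := Ideal.span {(X ^ 2 - C d : R[X])} with hI
  have hmap : I = I.map ((algEquivAevalNegX : R[X] ≃ₐ[R] R[X]) : R[X] →+* R[X]) := by
    rw [hI, Ideal.map_span, Set.image_singleton]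
    simp [algEquivAevalNegX]
  refine isIntegrallyClosed_of_sq_eq_squarefree (z := Ideal.Quotient.mk I X) ?_ h2 hd ?_ ?_
    (Ideal.quotientEquivAlg I I algEquivAevalNegX hmap) ?_
  · rw [injective_iff_map_eq_zero]
    intro r hr
    have hr' : (X ^ 2 - C d : R[X]) ∣ C r := by
      rw [← Ideal.mem_span_singleton, ← Ideal.Quotient.eq_zero_iff_mem]
      exact hr
    by_contra hr0
    have := natDegree_le_of_dvd hr' (C_ne_zero.mpr hr0)
    rw [hdeg, natDegree_C] at this
    omega
  · rw [← map_pow]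
    change _ = Ideal.Quotient.mk I (C d)
    rw [Ideal.Quotient.eq]
    exact Ideal.mem_span_singleton_self _
  · intro s
    obtain ⟨p, rfl⟩ := Ideal.Quotient.mk_surjective s
    have hlt := natDegree_modByMonic_lt p hmonic (by rintro h; simp [h] at hdeg)
    obtain ⟨b, a, hab⟩ := exists_eq_X_add_C_of_natDegree_le_one (p := p %ₘ (X ^ 2 - C d)) (by omega)
    refine ⟨a, b, ?_⟩
    change _ = Ideal.Quotient.mk I (C a) + Ideal.Quotient.mk I (C b) * _
    rw [← map_mul, ← map_add, add_comm, ← hab, Ideal.Quotient.eq, Ideal.mem_span_singleton]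
    refine ⟨p /ₘ (X ^ 2 - C d), ?_⟩
    linear_combination (modByMonic_add_div p (X ^ 2 - C d)).symm
  · rw [Ideal.quotientEquivAlg_mk]
    simp [algEquivAevalNegX]

namespace MvPolynomial

theorem totalDegree_aeval_le {σ τ R : Type*} [CommSemiring R] {f : σ → MvPolynomial τ R}
    (hf : ∀ i, (f i).totalDegree ≤ 1) (p : MvPolynomial σ R) :
    (aeval f p).totalDegree ≤ p.totalDegree := by
  rw [aeval_def, eval₂_eq]
  refine totalDegree_finsetSum_le fun s hs ↦ ?_
  refine (totalDegree_mul _ _).trans ?_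
  rw [algebraMap_eq, totalDegree_C, zero_add]
  refine (totalDegree_finsetProd _ _).trans (le_trans ?_ (le_totalDegree hs))
  refine Finset.sum_le_sum fun i _ ↦ (totalDegree_pow _ _).trans ?_
  exact (Nat.mul_le_mul_left _ (hf i)).trans_eq (mul_one _)

theorem squarefree_prod_X {σ R : Type*} [CommRing R] [IsDomain R]
    [UniqueFactorizationMonoid R] (s : Finset σ) :
    Squarefree (∏ i ∈ s, (X i : MvPolynomial σ R)) := by
  refine Finset.squarefree_prod_of_pairwise_isCoprime (fun i _ j _ hij ↦ ?_)
    fun i _ ↦ X_prime.squarefree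
  refine X_prime.irreducible.isRelPrime_iff_not_dvd.mpr fun h ↦ hij ?_
  simpa using h

/-- A polynomial is squarefree if a substitution by polynomials of degree at most one sends it to
a squarefree polynomial without lowering its degree. -/
theorem squarefree_of_squarefree_aeval {σ τ K : Type*} [Field K] {f : σ → MvPolynomial τ K}
    (hf : ∀ i, (f i).totalDegree ≤ 1) {p : MvPolynomial σ K} (hp : Squarefree (aeval f p))
    (hdeg : p.totalDegree ≤ (aeval f p).totalDegree) : Squarefree p := by
  rintro q ⟨r, rfl⟩
  have hne := hp.ne_zero
  have hq : IsUnit (aeval f q) := hp _ (by rw [map_mul, map_mul]; exact dvd_mul_right _ _)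
  have hq0 : q ≠ 0 := by rintro rfl; simp at hne
  have hr0 : r ≠ 0 := by rintro rfl; simp at hne
  rw [map_mul, map_mul] at hne hdeg
  have hr1 := right_ne_zero_of_mul hne
  rw [totalDegree_mul_of_isDomain (mul_ne_zero hq0 hq0) hr0, totalDegree_mul_of_isDomain hq0 hq0,
    totalDegree_mul_of_isDomain (left_ne_zero_of_mul hne) hr1,
    totalDegree_mul_of_isDomain hq.ne_zero hq.ne_zero,
    (isUnit_iff_totalDegree_of_isReduced.mp hq).2] at hdeg
  have hqd : q.totalDegree = 0 := by
    have := totalDegree_aeval_le hf r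
    omega
  rw [totalDegree_eq_zero_iff_eq_C] at hqd
  rw [hqd] at hq0 ⊢
  exact (isUnit_iff_ne_zero.mpr (by simpa using hq0)).map C

end MvPolynomial

theorem totalDegree_det_genericSymMatrix_le (n : ℕ) :
    (genericSymMatrix n).det.totalDegree ≤ n := by
  rw [Matrix.det_apply]
  refine MvPolynomial.totalDegree_finsetSum_le fun σ _ ↦ ?_
  rw [Units.smul_def]
  refine (MvPolynomial.totalDegree_smul_le _ _).trans ?_
  refine (MvPolynomial.totalDegree_finsetProd _ _).trans ?_
  refine (Finset.sum_le_sum fun i _ ↦ (MvPolynomial.totalDegree_X _).le).trans ?_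
  simp

/-- The value at each variable of the restriction to diagonal matrices. -/
noncomputable def diagSubst (n : ℕ) (v : SymVar n) : MvPolynomial (Fin n) ℂ :=
  if v.1.1 = v.1.2 then MvPolynomial.X v.1.1 else 0

theorem totalDegree_diagSubst_le (n : ℕ) (v : SymVar n) : (diagSubst n v).totalDegree ≤ 1 := by
  unfold diagSubst
  split_ifs <;> simp

theorem aeval_diagSubst_det (n : ℕ) :
    MvPolynomial.aeval (diagSubst n) (genericSymMatrix n).det = ∏ i, MvPolynomial.X i := by
  rw [AlgHom.map_det, ← Matrix.det_diagonal]
  congr 1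
  ext1 i j
  refine (MvPolynomial.aeval_X (diagSubst n) _).trans ?_
  by_cases h : i = j <;> simp [diagSubst, h]

theorem totalDegree_prod_X (n : ℕ) :
    (∏ i : Fin n, (MvPolynomial.X i : MvPolynomial (Fin n) ℂ)).totalDegree = n := by
  have h : (∏ i : Fin n, (MvPolynomial.X i : MvPolynomial (Fin n) ℂ)).IsHomogeneous
      (∑ _i : Fin n, 1) :=
    MvPolynomial.IsHomogeneous.prod _ _ _ fun i _ ↦ MvPolynomial.isHomogeneous_X ℂ i
  simpa using h.totalDegree (Finset.prod_ne_zero_iff.mpr fun i _ ↦ MvPolynomial.X_ne_zero i)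

theorem squarefree_det_genericSymMatrix (n : ℕ) : Squarefree (genericSymMatrix n).det := by
  apply MvPolynomial.squarefree_of_squarefree_aeval (totalDegree_diagSubst_le n) <;>
    rw [aeval_diagSubst_det]
  · exact MvPolynomial.squarefree_prod_X _
  · exact (totalDegree_det_genericSymMatrix_le n).trans_eq (totalDegree_prod_X n).symm

theorem not_isUnit_det_genericSymMatrix {n : ℕ} (hn : 1 ≤ n) :
    ¬ IsUnit (genericSymMatrix n).det := by
  intro h
  have h' := h.map (MvPolynomial.aeval (diagSubst n))
  rw [aeval_diagSubst_det, MvPolynomial.isUnit_iff_totalDegree_of_isReduced,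
    totalDegree_prod_X] at h'
  omega

/-- For every `n ≥ 1`, the ring
`ℂ[x_{ij} (1 ≤ i ≤ j ≤ n), z] / (z² − det M)` is an integrally closed integral
domain; equivalently, the affine variety `ℍ_n` is a normal variety. -/
theorem statement_15 (n : ℕ) (hn : 1 ≤ n) :
    IsDomain (HnCoordRing n) ∧ IsIntegrallyClosed (HnCoordRing n) := by
  have h2 : IsUnit (2 : MvPolynomial (SymVar n) ℂ) := by
    rw [← map_ofNat MvPolynomial.C 2]
    exact (isUnit_iff_ne_zero.mpr two_ne_zero).map MvPolynomial.C
  exact isDomain_and_isIntegrallyClosed_quotient_X_sq_sub_C h2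
    (squarefree_det_genericSymMatrix n) (not_isUnit_det_genericSymMatrix hn)
end

section
/- For every integer n ≥ 1, the image of the map Mat_n(ℂ) → Sym_n × ℂ sending f to (fᵀ·f, det f) is exactly ℍ_n = {(h, z) ∈ Sym_n × ℂ : z² = det(h)}. That is: (i) for every f ∈ Mat_n(ℂ), the matrix fᵀf is symmetric and det(fᵀf) = (det f)²; and (ii) for every symmetric matrix h ∈ Mat_n(ℂ) and every z ∈ ℂ with z² = det(h), there exists f ∈ Mat_n(ℂ) with fᵀf = h and det f = z. -/
open Matrix

/-- Over an algebraically closed field of characteristic not two, every symmetric matrix is of the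
form `fᵀ * f`. -/
theorem exists_transpose_mul_self_eq {K ι : Type*} [Field K] [IsAlgClosed K] [Invertible (2 : K)]
    [Fintype ι] [DecidableEq ι] {h : Matrix ι ι K} (hs : hᵀ = h) :
    ∃ f : Matrix ι ι K, fᵀ * f = h := by
  have hB : (toBilin' h).IsSymm := isSymm_toBilin'_iff_isSymm.mpr hs
  obtain ⟨v₀, hv₀⟩ := LinearMap.BilinForm.exists_orthogonal_basis (B := toBilin' h) ⟨hB.eq⟩
  let e : Fin (Module.finrank K (ι → K)) ≃ ι := Fintype.equivOfCardEq (by simp)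
  let v := v₀.reindex e
  choose s hsq using fun i => IsAlgClosed.exists_eq_mul_self (toBilin' h (v i) (v i))
  have hd : LinearMap.BilinForm.toMatrix v (toBilin' h) = diagonal s * diagonal s := by
    ext i j
    rw [LinearMap.BilinForm.toMatrix_apply, diagonal_mul_diagonal, diagonal_apply]
    split_ifs with hij
    · rw [← hij, hsq]
    · simpa [v] using hv₀ (e.symm.injective.ne hij)
  refine ⟨diagonal s * v.toMatrix (Pi.basisFun K ι), ?_⟩
  have key := LinearMap.BilinForm.toMatrix_mul_basis_toMatrix v (Pi.basisFun K ι)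
    (toBilin' h)
  rw [hd, LinearMap.BilinForm.toMatrix_basisFun, LinearMap.BilinForm.toMatrix'_toBilin'] at key
  rw [← key]
  simp only [transpose_mul, diagonal_transpose, Matrix.mul_assoc]

/-- On a nonempty index type, `f` can be replaced by a matrix with the same Gram matrix and
opposite determinant. -/
theorem exists_transpose_mul_self_eq_det_neg {R ι : Type*} [CommRing R] [Fintype ι] [DecidableEq ι]
    [Nonempty ι] (f : Matrix ι ι R) :
    ∃ g : Matrix ι ι R, gᵀ * g = fᵀ * f ∧ g.det = -f.det := by
  let i₀ : ι := Classical.arbitrary ι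
  let d : ι → R := Function.update 1 i₀ (-1)
  have hdd : diagonal d * diagonal d = 1 := by
    rw [diagonal_mul_diagonal, ← diagonal_one]
    congr 1
    ext i
    by_cases hi : i = i₀ <;> simp [d, hi]
  refine ⟨diagonal d * f, ?_, ?_⟩
  · rw [transpose_mul, diagonal_transpose, Matrix.mul_assoc,
      ← Matrix.mul_assoc (diagonal d), hdd, Matrix.one_mul]
  · rw [det_mul, det_diagonal, Finset.prod_update_of_mem (Finset.mem_univ i₀)]
    simp

/-- For every `n ≥ 1`, the image of the map `Mat_n(ℂ) → Sym_n × ℂ`,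
`f ↦ (fᵀ·f, det f)`, is exactly `ℍ_n = {(h, z) : z² = det h}`:
(i) for every `f`, the matrix `fᵀ * f` is symmetric and `det (fᵀ * f) = (det f)²`;
(ii) for every symmetric `h` and every `z` with `z² = det h` there is `f` with
`fᵀ * f = h` and `det f = z`. -/
theorem statement_16 (n : ℕ) (hn : 1 ≤ n) :
    (∀ f : Matrix (Fin n) (Fin n) ℂ,
      (fᵀ * f)ᵀ = fᵀ * f ∧ (fᵀ * f).det = f.det ^ 2) ∧
    (∀ h : Matrix (Fin n) (Fin n) ℂ, hᵀ = h → ∀ z : ℂ, z ^ 2 = h.det →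
      ∃ f : Matrix (Fin n) (Fin n) ℂ, fᵀ * f = h ∧ f.det = z) := by
  have : Nonempty (Fin n) := ⟨⟨0, hn⟩⟩
  refine ⟨fun f => ⟨by simp, by rw [det_mul, det_transpose, sq]⟩, fun h hs z hz => ?_⟩
  obtain ⟨f, hf⟩ := exists_transpose_mul_self_eq hs
  have hdet : z ^ 2 = f.det ^ 2 := by rw [hz, ← hf, det_mul, det_transpose, sq]
  rcases sq_eq_sq_iff_eq_or_eq_neg.mp hdet with rfl | rfl
  · exact ⟨f, hf, rfl⟩
  · obtain ⟨g, hg, hgd⟩ := exists_transpose_mul_self_eq_det_neg f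
    exact ⟨g, hg.trans hf, hgd⟩
end
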